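/- Let n be a positive integer, G a finite group, and φ : Γ(n) → G a group homomorphism such that φ(γ) = 1 for every parabolic element γ of Γ(n), and such that φ(−I) = 1 whenever −I ∈ Γ(n). If ker φ ≠ Γ(n), then ker φ, viewed as a subgroup of SL₂(ℤ), is not a congruence subgroup; i.e., ker φ contains no principal congruence subgroup Γ(m). -/

import Mathlib

open Matrix Matrix.SpecialLinearGroup CongruenceSubgroup

open scoped MatrixGroups

/-- An element of `SL(2, ℤ)` is parabolic if it is not `±I` and its trace is `±2`. -/
def IsParabolic (γ : SL(2, ℤ)) : Prop :=
  γ ≠ 1 ∧ γ ≠ -1 ∧ ((γ 0 0 : ℤ) + γ 1 1 = 2 ∨ (γ 0 0 : ℤ) + γ 1 1 = -2)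

/-- For coprime `a` and `c`, some translate of `a` by a multiple of `c` is coprime to `M ≠ 0`. -/
theorem exists_isCoprime_add_mul {a c M : ℤ} (h : IsCoprime a c) (hM : M ≠ 0) :
    ∃ k : ℤ, IsCoprime (a + k * c) M := by
  let ps : Finset ℕ := {p ∈ M.natAbs.primeFactors | ¬(p : ℤ) ∣ a}
  refine ⟨∏ p ∈ ps, (p : ℤ), Int.isCoprime_iff_gcd_eq_one.mpr <| Nat.coprime_of_dvd ?_⟩
  intro p pp hp hpM
  have hpp : Prime (p : ℤ) := Nat.prime_iff_prime_int.mp pp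
  rw [← Int.natCast_dvd] at hp
  by_cases hpa : (p : ℤ) ∣ a
  · rcases hpp.dvd_mul.mp ((dvd_add_right hpa).mp hp) with hk | hc
    · obtain ⟨q, hq, hpq⟩ := (hpp.dvd_finsetProd_iff _).mp hk
      have hq' := Finset.mem_filter.mp hq
      rw [Int.natCast_dvd_natCast,
        Nat.prime_dvd_prime_iff_eq pp (Nat.prime_of_mem_primeFactors hq'.1)] at hpq
      exact hq'.2 (hpq ▸ hpa)
    · exact hpp.not_isUnit (h.isUnit_of_dvd' hpa hc)
  · have hps : p ∈ ps := Finset.mem_filter.mpr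
      ⟨Nat.mem_primeFactors.mpr ⟨pp, hpM, Int.natAbs_ne_zero.mpr hM⟩, hpa⟩
    exact hpa ((dvd_add_left
      ((Finset.dvd_prod_of_mem (fun p : ℕ => (p : ℤ)) hps).mul_right c)).mp hp)

/-- If `a` is a unit modulo `M`, then some multiple of `a` is congruent to `b` modulo `M`. -/
theorem exists_dvd_add_mul_sub {a M : ℤ} (h : IsCoprime a M) (b b' : ℤ) :
    ∃ k : ℤ, M ∣ b + k * a - b' := by
  obtain ⟨u, v, huv⟩ := h
  exact ⟨(b' - b) * u, (b - b') * v, by linear_combination (b' - b) * huv⟩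

/-- The upper unipotent matrix with off-diagonal entry `k`. -/
def upperUnipotent (k : ℤ) : SL(2, ℤ) := ⟨!![1, k; 0, 1], by simp⟩

/-- The lower unipotent matrix with off-diagonal entry `k`. -/
def lowerUnipotent (k : ℤ) : SL(2, ℤ) := ⟨!![1, 0; k, 1], by simp⟩

@[simp]
theorem coe_upperUnipotent (k : ℤ) :
    (upperUnipotent k : Matrix (Fin 2) (Fin 2) ℤ) = !![1, k; 0, 1] := rfl

@[simp]
theorem coe_lowerUnipotent (k : ℤ) :
    (lowerUnipotent k : Matrix (Fin 2) (Fin 2) ℤ) = !![1, 0; k, 1] := rfl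

/-- A parabolic element of `Γ(n)` with upper left entry `1 + n * x`. -/
def parabolicWithCorner (n x : ℤ) : SL(2, ℤ) :=
  ⟨!![1 + n * x, n * x ^ 2; -n, 1 - n * x], by rw [Matrix.det_fin_two_of]; ring⟩

@[simp]
theorem coe_parabolicWithCorner (n x : ℤ) :
    (parabolicWithCorner n x : Matrix (Fin 2) (Fin 2) ℤ) =
      !![1 + n * x, n * x ^ 2; -n, 1 - n * x] := rfl

section ParabolicMem

variable {n : ℕ} {K : Subgroup SL(2, ℤ)}

theorem upperUnipotent_mem (hK : ∀ γ ∈ Gamma n, _root_.IsParabolic γ → γ ∈ K) (k : ℤ) :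
    upperUnipotent (n * k) ∈ K := by
  by_cases h : (n : ℤ) * k = 0
  · convert K.one_mem
    ext i j
    fin_cases i <;> fin_cases j <;> simp [h]
  · refine hK _ (by simp) ⟨fun e => h ?_, fun e => h ?_, Or.inl ?_⟩
    · simpa using congrArg (fun γ : SL(2, ℤ) => γ 0 1) e
    · simpa using congrArg (fun γ : SL(2, ℤ) => γ 0 1) e
    · simp

theorem lowerUnipotent_mem (hK : ∀ γ ∈ Gamma n, _root_.IsParabolic γ → γ ∈ K) (k : ℤ) :
    lowerUnipotent (n * k) ∈ K := by
  by_cases h : (n : ℤ) * k = 0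
  · convert K.one_mem
    ext i j
    fin_cases i <;> fin_cases j <;> simp [h]
  · refine hK _ (by simp) ⟨fun e => h ?_, fun e => h ?_, Or.inl ?_⟩
    · simpa using congrArg (fun γ : SL(2, ℤ) => γ 1 0) e
    · simpa using congrArg (fun γ : SL(2, ℤ) => γ 1 0) e
    · simp

theorem parabolicWithCorner_mem (hn : n ≠ 0) (hK : ∀ γ ∈ Gamma n, _root_.IsParabolic γ → γ ∈ K)
    (x : ℤ) : parabolicWithCorner n x ∈ K := by
  refine hK _ (by simp) ⟨fun e => hn ?_, fun e => hn ?_, Or.inl ?_⟩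
  · simpa using congrArg (fun γ : SL(2, ℤ) => γ 1 0) e
  · simpa using congrArg (fun γ : SL(2, ℤ) => γ 1 0) e
  · simp

end ParabolicMem

/-- Two matrices with the same upper left entry, a unit modulo `M`, and off-diagonal entries
congruent modulo `M`, are congruent modulo `M`. -/
theorem mul_inv_mem_Gamma {M : ℕ} {A B : SL(2, ℤ)} (ha : IsCoprime (A 0 0) M)
    (h00 : A 0 0 = B 0 0) (h01 : (M : ℤ) ∣ A 0 1 - B 0 1) (h10 : (M : ℤ) ∣ A 1 0 - B 1 0) :
    A * B⁻¹ ∈ Gamma M := by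
  have h11 : (M : ℤ) ∣ A 1 1 - B 1 1 := by
    refine ha.symm.dvd_of_dvd_mul_left ?_
    have hA := A.det_coe
    have hB := B.det_coe
    rw [Matrix.det_fin_two] at hA hB
    have e : A 0 0 * (A 1 1 - B 1 1) =
        (A 0 1 - B 0 1) * A 1 0 + B 0 1 * (A 1 0 - B 1 0) := by
      linear_combination hA - hB - B 1 1 * h00
    rw [e]
    exact dvd_add (h01.mul_right _) (h10.mul_left _)
  have cast_eq : ∀ {s t : ℤ}, (M : ℤ) ∣ s - t → (s : ZMod M) = t := fun h =>
    ((ZMod.intCast_eq_intCast_iff_dvd_sub _ _ _).mpr h).symm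
  rw [Gamma_mem', map_mul, map_inv, mul_inv_eq_one]
  ext i j
  fin_cases i <;> fin_cases j
  · exact congrArg _ h00
  · exact cast_eq h01
  · exact cast_eq h10
  · exact cast_eq h11

/-- A subgroup containing the parabolic elements of `Γ(n)` and some `Γ(M)` contains `Γ(n)`. -/
theorem Gamma_le_of_parabolic_mem {n M : ℕ} (hn : n ≠ 0) (hM : M ≠ 0) {K : Subgroup SL(2, ℤ)}
    (hK : ∀ γ ∈ Gamma n, _root_.IsParabolic γ → γ ∈ K) (hMK : Gamma M ≤ K) : Gamma n ≤ K := by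
  have of_corner : ∀ γ ∈ Gamma n, IsCoprime (γ 0 0) M → γ ∈ K := by
    intro γ hγ hcop
    obtain ⟨h00, h01, h10, -⟩ := Gamma_mem.mp hγ
    obtain ⟨x, hx⟩ : (n : ℤ) ∣ γ 0 0 - 1 :=
      (ZMod.intCast_eq_intCast_iff_dvd_sub _ _ _).mp (by simpa using h00.symm)
    obtain ⟨b, hb⟩ := (ZMod.intCast_zmod_eq_zero_iff_dvd _ _).mp h01
    obtain ⟨c, hc⟩ := (ZMod.intCast_zmod_eq_zero_iff_dvd _ _).mp h10
    obtain ⟨k, hk⟩ := exists_dvd_add_mul_sub hcop b (x ^ 2)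
    obtain ⟨l, hl⟩ := exists_dvd_add_mul_sub hcop c (-1)
    set A : SL(2, ℤ) := lowerUnipotent (n * l) * γ * upperUnipotent (n * k) with hA
    have A00 : A 0 0 = γ 0 0 := by
      simp [hA, Matrix.mul_apply, Matrix.vecMul, dotProduct, Fin.sum_univ_two]
    have A01 : A 0 1 = γ 0 0 * (n * k) + γ 0 1 := by
      simp [hA, Matrix.mul_apply, Matrix.vecMul, dotProduct, Fin.sum_univ_two]
    have A10 : A 1 0 = n * l * γ 0 0 + γ 1 0 := by
      simp [hA, Matrix.mul_apply, Matrix.vecMul, dotProduct, Fin.sum_univ_two]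
    have hAK : A ∈ K := by
      have hP := parabolicWithCorner_mem hn hK x
      refine (K.mul_mem_cancel_right (K.inv_mem hP)).mp (hMK (mul_inv_mem_Gamma ?_ ?_ ?_ ?_))
      · rwa [A00]
      · simp only [A00, coe_parabolicWithCorner, of_apply, cons_val', cons_val_zero]
        linear_combination hx
      · have e : A 0 1 - parabolicWithCorner n x 0 1 = n * (b + k * γ 0 0 - x ^ 2) := by
          simp only [A01, hb, coe_parabolicWithCorner, of_apply, cons_val', cons_val_zero,
            cons_val_one]
          ring
        exact e ▸ hk.mul_left _
      · have e : A 1 0 - parabolicWithCorner n x 1 0 = n * (c + l * γ 0 0 - -1) := by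
          simp only [A10, hc, coe_parabolicWithCorner, of_apply, cons_val', cons_val_zero,
            cons_val_one]
          ring
        exact e ▸ hl.mul_left _
    rwa [hA, K.mul_mem_cancel_right (upperUnipotent_mem hK k),
      K.mul_mem_cancel_left (lowerUnipotent_mem hK l)] at hAK
  intro γ hγ
  have hdet := γ.det_coe
  rw [Matrix.det_fin_two] at hdet
  obtain ⟨x, hx⟩ : (n : ℤ) ∣ γ 0 0 - 1 :=
    (ZMod.intCast_eq_intCast_iff_dvd_sub _ _ _).mp (by simpa using (Gamma_mem.mp hγ).1.symm)
  have hcop : IsCoprime (γ 0 0) (n * γ 0 1) :=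
    IsCoprime.mul_right ⟨1, -x, by linear_combination hx⟩
      ⟨γ 1 1, -γ 1 0, by linear_combination hdet⟩
  obtain ⟨k, hk⟩ := exists_isCoprime_add_mul hcop (Int.natCast_ne_zero.mpr hM)
  refine (K.mul_mem_cancel_right (lowerUnipotent_mem hK k)).mp (of_corner _ ?_ ?_)
  · exact (Gamma n).mul_mem hγ (by simp)
  · convert hk using 1
    simp [Matrix.mul_apply, Fin.sum_univ_two]
    ring

/-- the `Γ(n)` case of Proposition 3.4 of the paper.
Let `n ≥ 1`, `G` a finite group, and `φ : Γ(n) → G` a homomorphism killing all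
parabolic elements of `Γ(n)`, and killing `-I` whenever `-I ∈ Γ(n)`.  If
`ker φ ≠ Γ(n)`, then `ker φ` (viewed inside `SL(2, ℤ)`) is not a congruence
subgroup, i.e. it contains no principal congruence subgroup `Γ(m)`. -/
theorem kernel_of_typeII_hom_on_Gamma_noncongruence
    (n : ℕ) (hn : 0 < n) {G : Type*} [Group G] [Finite G]
    (φ : CongruenceSubgroup.Gamma n →* G)
    (hI : ∀ γ : CongruenceSubgroup.Gamma n, (γ : SL(2, ℤ)) = -1 → φ γ = 1)
    (hpar : ∀ γ : CongruenceSubgroup.Gamma n, IsParabolic (γ : SL(2, ℤ)) → φ γ = 1)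
    (hker : φ.ker ≠ ⊤) :
    ∀ m : ℕ, 1 ≤ m →
      ¬ CongruenceSubgroup.Gamma m ≤
          Subgroup.map (CongruenceSubgroup.Gamma n).subtype φ.ker := by
  intro m hm hle
  have hΓ : Gamma n ≤ Subgroup.map (Gamma n).subtype φ.ker :=
    Gamma_le_of_parabolic_mem hn.ne' (Nat.one_le_iff_ne_zero.mp hm)
      (fun γ hγ hp => ⟨⟨γ, hγ⟩, hpar ⟨γ, hγ⟩ hp, rfl⟩) hle
  refine hker (eq_top_iff.mpr fun γ _ => ?_)
  obtain ⟨δ, hδ, e⟩ := hΓ γ.2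
  rwa [← Subtype.ext e]
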